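/- arXiv:2009.00241 — 2 statements merged into one kernel-verified Lean document; each statement's English description precedes it below -/
import Mathlib

section
/- Let f : (0,∞) → ℝ admit the representation f(t) = a + b·t + ∫₀^∞ (tλ)/(t+λ) dw(λ) for all t > 0, where a ∈ ℝ, b ≥ 0 and w is a positive measure on (0,∞) with ∫₀^∞ λ/(1+λ) dw(λ) < ∞. Then for all strictly positive operators C, D, Q on a complex Hilbert space H, 𝒫_f(Q,D) − 𝒫_f(Q,C) = a(D − C) + ∫₀^∞ λ [ ∫₀¹ Q (Q + λ((1−t)C + tD))⁻¹ (D − C) (Q + λ((1−t)C + tD))⁻¹ Q dt ] dw(λ). -/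
open MeasureTheory

variable {H : Type*} [NormedAddCommGroup H] [InnerProductSpace ℂ H] [CompleteSpace H]

/-- An operator `T` on a complex Hilbert space is *strictly positive* if
`⟪T x, x⟫ ≥ 0` for all `x` and `T` is invertible. -/
def StrictlyPos (T : H →L[ℂ] H) : Prop := T.IsPositive ∧ IsUnit T

/-- `A^{1/2}` via the continuous functional calculus. -/
noncomputable def opSqrt (A : H →L[ℂ] H) : H →L[ℂ] H := cfc Real.sqrt A

/-- `A^{-1/2}` via the continuous functional calculus. -/
noncomputable def opInvSqrt (A : H →L[ℂ] H) : H →L[ℂ] H :=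
  cfc (fun x : ℝ => (Real.sqrt x)⁻¹) A

/-- The noncommutative perspective `𝒫_f(B, A) := A^{1/2} f(A^{-1/2} B A^{-1/2}) A^{1/2}`. -/
noncomputable def persp (f : ℝ → ℝ) (B A : H →L[ℂ] H) : H →L[ℂ] H :=
  opSqrt A * cfc f (opInvSqrt A * B * opInvSqrt A) * opSqrt A

/-- The weighted operator geometric mean `A ♯_ν B := A^{1/2} (A^{-1/2} B A^{-1/2})^ν A^{1/2}`. -/
noncomputable def gmean (ν : ℝ) (A B : H →L[ℂ] H) : H →L[ℂ] H :=
  opSqrt A * cfc (fun x : ℝ => x ^ ν) (opInvSqrt A * B * opInvSqrt A) * opSqrt A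

/-- The relative operator entropy `S(A|B) := A^{1/2} ln(A^{-1/2} B A^{-1/2}) A^{1/2}`. -/
noncomputable def relEntropy (A B : H →L[ℂ] H) : H →L[ℂ] H :=
  opSqrt A * cfc Real.log (opInvSqrt A * B * opInvSqrt A) * opSqrt A

theorem strictlyPos_iff_isStrictlyPositive {T : H →L[ℂ] H} :
    StrictlyPos T ↔ IsStrictlyPositive T := by
  rw [StrictlyPos, IsStrictlyPositive.iff_of_unital, ContinuousLinearMap.nonneg_iff_isPositive]

section SquareRoot

variable {A : H →L[ℂ] H}

theorem isSelfAdjoint_opInvSqrt : IsSelfAdjoint (opInvSqrt A) := cfc_predicate _ A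

theorem opSqrt_mul_self (hA : IsStrictlyPositive A) : opSqrt A * opSqrt A = A := by
  rw [opSqrt, ← cfc_mul Real.sqrt Real.sqrt A]
  conv_rhs => rw [← cfc_id' ℝ A]
  exact cfc_congr fun x hx => Real.mul_self_sqrt (hA.spectrum_pos hx).le

theorem continuousOn_inv_sqrt_spectrum (hA : IsStrictlyPositive A) :
    ContinuousOn (fun x : ℝ => (Real.sqrt x)⁻¹) (spectrum ℝ A) :=
  Real.continuous_sqrt.continuousOn.inv₀ fun _ hx =>
    (Real.sqrt_pos.2 (hA.spectrum_pos hx)).ne'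

theorem opSqrt_mul_opInvSqrt (hA : IsStrictlyPositive A) : opSqrt A * opInvSqrt A = 1 := by
  rw [opSqrt, opInvSqrt, ← cfc_mul Real.sqrt _ A (by fun_prop) (continuousOn_inv_sqrt_spectrum hA),
    ← cfc_const_one ℝ A]
  exact cfc_congr fun x hx => mul_inv_cancel₀ (Real.sqrt_pos.2 (hA.spectrum_pos hx)).ne'

theorem opInvSqrt_mul_opSqrt (hA : IsStrictlyPositive A) : opInvSqrt A * opSqrt A = 1 := by
  rw [opSqrt, opInvSqrt, ← cfc_mul _ Real.sqrt A (continuousOn_inv_sqrt_spectrum hA) (by fun_prop),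
    ← cfc_const_one ℝ A]
  exact cfc_congr fun x hx => inv_mul_cancel₀ (Real.sqrt_pos.2 (hA.spectrum_pos hx)).ne'

theorem isUnit_opInvSqrt (hA : IsStrictlyPositive A) : IsUnit (opInvSqrt A) :=
  ⟨⟨_, _, opInvSqrt_mul_opSqrt hA, opSqrt_mul_opInvSqrt hA⟩, rfl⟩

theorem isStrictlyPositive_conj_opInvSqrt {Q : H →L[ℂ] H} (hA : IsStrictlyPositive A)
    (hQ : IsStrictlyPositive Q) : IsStrictlyPositive (opInvSqrt A * Q * opInvSqrt A) :=
  hQ.conjugate_of_isUnit_of_isSelfAdjoint _ _ (isUnit_opInvSqrt hA) isSelfAdjoint_opInvSqrt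

theorem opSqrt_conj_conj_opInvSqrt (hA : IsStrictlyPositive A) (Q : H →L[ℂ] H) :
    opSqrt A * (opInvSqrt A * Q * opInvSqrt A) * opSqrt A = Q := by
  have h1 := opSqrt_mul_opInvSqrt hA
  have h2 := opInvSqrt_mul_opSqrt hA
  calc _ = (opSqrt A * opInvSqrt A) * Q * (opInvSqrt A * opSqrt A) := by simp only [mul_assoc]
    _ = Q := by rw [h1, h2, one_mul, mul_one]

end SquareRoot

section Resolvent

variable {X A Q : H →L[ℂ] H} {l : ℝ}

theorem continuousOn_mul_div_add :
    ContinuousOn (Function.uncurry fun l t : ℝ => t * l / (t + l)) (Set.Ioi 0 ×ˢ Set.Ioi 0) := by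
  refine ContinuousOn.div (by fun_prop) (by fun_prop) ?_
  rintro ⟨l, t⟩ ⟨hl, ht⟩
  exact (add_pos (Set.mem_Ioi.1 ht) (Set.mem_Ioi.1 hl)).ne'

theorem norm_mul_div_add_le {t K : ℝ} (ht : 0 < t) (hl : 0 < l) (hK : t ≤ K) :
    ‖t * l / (t + l)‖ ≤ (1 + K) * (l / (1 + l)) := by
  rw [Real.norm_of_nonneg (by positivity), ← mul_div_assoc,
    div_le_div_iff₀ (by positivity) (by positivity)]
  nlinarith [mul_pos ht hl, mul_nonneg (mul_pos ht hl).le (sub_nonneg.2 hK),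
    mul_nonneg hl.le (sub_nonneg.2 hK), mul_nonneg (mul_pos hl hl).le (sub_nonneg.2 hK),
    mul_pos hl hl, mul_pos (mul_pos ht hl) ht]

theorem spectrum_subset_Ioi (hX : IsStrictlyPositive X) : spectrum ℝ X ⊆ Set.Ioi 0 :=
  fun _ hx => hX.spectrum_pos hx

theorem cfc_mul_div_add_mul (hX : IsStrictlyPositive X) (hl : 0 < l) :
    cfc (fun t : ℝ => t * l / (t + l)) X * (X + l • 1) = l • X := by
  have hc : ContinuousOn (fun t : ℝ => t * l / (t + l)) (spectrum ℝ X) :=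
    ContinuousOn.div (by fun_prop) (by fun_prop)
      fun t ht => (add_pos (hX.spectrum_pos ht) hl).ne'
  have hXl : X + l • 1 = cfc (fun t : ℝ => t + l) X := by
    rw [cfc_add_const l (fun t : ℝ => t) X, cfc_id' ℝ X, Algebra.algebraMap_eq_smul_one]
  rw [hXl, ← cfc_mul _ _ X hc (by fun_prop), ← cfc_const_mul_id l X]
  refine cfc_congr fun t ht => ?_
  have : t + l ≠ 0 := (add_pos (hX.spectrum_pos ht) hl).ne'
  field_simp

theorem isStrictlyPositive_add_smul (hQ : IsStrictlyPositive Q) (hA : 0 ≤ A) (hl : 0 ≤ l) :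
    IsStrictlyPositive (Q + l • A) :=
  hQ.add_nonneg (smul_nonneg hl hA)

theorem opSqrt_conj_cfc_mul_div_add (hA : IsStrictlyPositive A) (hQ : IsStrictlyPositive Q)
    (hl : 0 < l) :
    opSqrt A * cfc (fun t : ℝ => t * l / (t + l)) (opInvSqrt A * Q * opInvSqrt A) * opSqrt A =
      l • (Q * Ring.inverse (Q + l • A) * A) := by
  set S := opSqrt A
  set I := opInvSqrt A
  set K := cfc (fun t : ℝ => t * l / (t + l)) (I * Q * I)
  have hIS : I * S = 1 := opInvSqrt_mul_opSqrt hA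
  have hSS : S * S = A := opSqrt_mul_self hA
  have hM : IsUnit (Q + l • A) := (isStrictlyPositive_add_smul hQ hA.nonneg hl.le).isUnit
  have hK : K * (I * Q * I + l • 1) = l • (I * Q * I) :=
    cfc_mul_div_add_mul (isStrictlyPositive_conj_opInvSqrt hA hQ) hl
  have hIM : (I * Q * I + l • 1) * S = I * (Q + l • A) := by
    rw [add_mul, mul_add, mul_assoc (I * Q), hIS, mul_one, smul_mul_assoc, one_mul,
      mul_smul_comm, ← hSS, ← mul_assoc I S S, hIS, one_mul]
  have h : S * K * I * (Q + l • A) = l • Q := by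
    calc S * K * I * (Q + l • A) = S * (K * (I * (Q + l • A))) := by simp only [mul_assoc]
      _ = S * ((K * (I * Q * I + l • 1)) * S) := by rw [← hIM, mul_assoc K]
      _ = l • (S * (I * Q * I) * S) := by
        rw [hK, smul_mul_assoc, mul_smul_comm, ← mul_assoc S]
      _ = l • Q := by rw [opSqrt_conj_conj_opInvSqrt hA]
  have h' : S * K * I = l • (Q * Ring.inverse (Q + l • A)) := by
    rw [← smul_mul_assoc, ← h, Ring.mul_inverse_cancel_right _ _ hM]
  calc S * K * S = S * K * ((I * S) * S) := by rw [hIS, one_mul]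
    _ = (S * K * I) * (S * S) := by simp only [mul_assoc]
    _ = _ := by rw [h', hSS, smul_mul_assoc]

end Resolvent

section Perspective

variable {f : ℝ → ℝ} {a b : ℝ} {w : Measure ℝ} {X A Q : H →L[ℂ] H}

theorem hasFiniteIntegral_bound
    (hw : IntegrableOn (fun l => l / (1 + l)) (Set.Ioi 0) w) (K : ℝ) :
    HasFiniteIntegral (fun l : ℝ => (1 + K) * (l / (1 + l))) (w.restrict (Set.Ioi 0)) :=
  (hw.integrable.const_mul (1 + K)).hasFiniteIntegral

theorem ae_norm_mul_div_add_le (hX : IsStrictlyPositive X) :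
    ∀ᵐ l ∂(w.restrict (Set.Ioi 0)), ∀ t ∈ spectrum ℝ X,
      ‖t * l / (t + l)‖ ≤ (1 + ‖X‖ * ‖(1 : H →L[ℂ] H)‖) * (l / (1 + l)) :=
  ae_restrict_of_forall_mem measurableSet_Ioi fun _ hl _ ht =>
    norm_mul_div_add_le (hX.spectrum_pos ht) hl
      ((le_abs_self _).trans (spectrum.norm_le_norm_mul_of_mem ht))

theorem integrableOn_cfc_mul_div_add (hX : IsStrictlyPositive X)
    (hw : IntegrableOn (fun l => l / (1 + l)) (Set.Ioi 0) w) :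
    IntegrableOn (fun l => cfc (fun t : ℝ => t * l / (t + l)) X) (Set.Ioi 0) w :=
  integrableOn_cfc measurableSet_Ioi (fun l t : ℝ => t * l / (t + l)) _ X
    (continuousOn_mul_div_add.mono (Set.prod_mono_right (spectrum_subset_Ioi hX)))
    (ae_norm_mul_div_add_le hX) (hasFiniteIntegral_bound hw _)

theorem cfc_eq_add_integral (hX : IsStrictlyPositive X) (hf : ContinuousOn f (Set.Ioi 0))
    (hw : IntegrableOn (fun l => l / (1 + l)) (Set.Ioi 0) w)
    (hrep : ∀ t > (0 : ℝ), f t = a + b * t + ∫ l in Set.Ioi 0, t * l / (t + l) ∂w) :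
    cfc f X = a • 1 + b • X + ∫ l in Set.Ioi 0, cfc (fun t : ℝ => t * l / (t + l)) X ∂w := by
  have hg : ContinuousOn (fun t : ℝ => ∫ l in Set.Ioi 0, t * l / (t + l) ∂w) (spectrum ℝ X) := by
    have : ContinuousOn (fun t => f t - (a + b * t)) (spectrum ℝ X) :=
      (hf.mono (spectrum_subset_Ioi hX)).sub (by fun_prop)
    exact this.congr fun t ht => by simp only [hrep t (hX.spectrum_pos ht)]; ring
  rw [← cfc_setIntegral measurableSet_Ioi (fun l t : ℝ => t * l / (t + l)) _ X
    (continuousOn_mul_div_add.mono (Set.prod_mono_right (spectrum_subset_Ioi hX)))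
    (ae_norm_mul_div_add_le hX) (hasFiniteIntegral_bound hw _),
    cfc_congr (fun t ht => hrep t (hX.spectrum_pos ht)),
    cfc_add X (fun t : ℝ => a + b * t) _ (by fun_prop) hg,
    cfc_const_add a (fun t : ℝ => b * t) X, cfc_const_mul_id b X, Algebra.algebraMap_eq_smul_one]

theorem integrableOn_smul_mul_inverse_mul (hA : IsStrictlyPositive A) (hQ : IsStrictlyPositive Q)
    (hw : IntegrableOn (fun l => l / (1 + l)) (Set.Ioi 0) w) :
    IntegrableOn (fun l : ℝ => l • (Q * Ring.inverse (Q + l • A) * A)) (Set.Ioi 0) w := by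
  have h := ((integrableOn_cfc_mul_div_add (isStrictlyPositive_conj_opInvSqrt hA hQ)
    hw).integrable.const_mul (opSqrt A)).mul_const (opSqrt A)
  exact IntegrableOn.congr_fun h (fun l hl => opSqrt_conj_cfc_mul_div_add hA hQ hl)
    measurableSet_Ioi

theorem persp_eq_add_integral (hA : IsStrictlyPositive A) (hQ : IsStrictlyPositive Q)
    (hf : ContinuousOn f (Set.Ioi 0))
    (hw : IntegrableOn (fun l => l / (1 + l)) (Set.Ioi 0) w)
    (hrep : ∀ t > (0 : ℝ), f t = a + b * t + ∫ l in Set.Ioi 0, t * l / (t + l) ∂w) :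
    persp f Q A = a • A + b • Q +
      ∫ l in Set.Ioi (0 : ℝ), l • (Q * Ring.inverse (Q + l • A) * A) ∂w := by
  have hX := isStrictlyPositive_conj_opInvSqrt hA hQ
  have hint := (integrableOn_cfc_mul_div_add hX hw).integrable
  rw [persp, cfc_eq_add_integral hX hf hw hrep, mul_add, add_mul, mul_add, add_mul,
    mul_smul_comm, mul_one, smul_mul_assoc, opSqrt_mul_self hA, mul_smul_comm, smul_mul_assoc,
    opSqrt_conj_conj_opInvSqrt hA, ← integral_const_mul_of_integrable hint,
    ← integral_mul_const_of_integrable (hint.const_mul _)]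
  congr 1
  exact setIntegral_congr_fun measurableSet_Ioi
    fun l hl => opSqrt_conj_cfc_mul_div_add hA hQ hl

end Perspective

section Segment

variable {C D Q : H →L[ℂ] H} {l : ℝ}

theorem smul_mul_inverse_mul_self (hQ : IsStrictlyPositive Q) (hD : 0 ≤ D) (hl : 0 ≤ l) :
    l • (Q * Ring.inverse (Q + l • D) * D) = Q - Q * Ring.inverse (Q + l • D) * Q := by
  have hM := (isStrictlyPositive_add_smul hQ hD hl).isUnit
  rw [← mul_smul_comm, eq_sub_iff_add_eq, ← mul_add, add_comm (l • D), Ring.inverse_mul_cancel_right _ _ hM]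

theorem hasDerivAt_mul_inverse_mul {M : ℝ → H →L[ℂ] H} {M' : H →L[ℂ] H} {t : ℝ}
    (hM : HasDerivAt M M' t) (hu : IsUnit (M t)) (P R : H →L[ℂ] H) :
    HasDerivAt (fun s => P * Ring.inverse (M s) * R)
      (-(P * Ring.inverse (M t) * M' * Ring.inverse (M t) * R)) t := by
  obtain ⟨u, hu⟩ := hu
  have h := (hu ▸ hasFDerivAt_ringInverse (𝕜 := ℝ) u :
    HasFDerivAt Ring.inverse _ (M t)).comp_hasDerivAt t hM
  refine ((h.const_mul P).mul_const R).congr_deriv ?_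
  simp [← hu, mul_assoc]

theorem smul_intervalIntegral_segment (hC : 0 ≤ C) (hD : 0 ≤ D)
    (hQ : IsStrictlyPositive Q) (hl : 0 ≤ l) :
    l • (∫ t in (0 : ℝ)..1, Q * Ring.inverse (Q + l • ((1 - t) • C + t • D)) * (D - C) *
        Ring.inverse (Q + l • ((1 - t) • C + t • D)) * Q) =
      Q * Ring.inverse (Q + l • C) * Q - Q * Ring.inverse (Q + l • D) * Q := by
  set M : ℝ → H →L[ℂ] H := fun t => Q + l • ((1 - t) • C + t • D) with hMdef
  have hu : ∀ t ∈ Set.uIcc (0 : ℝ) 1, IsUnit (M t) := by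
    intro t ht
    rw [Set.uIcc_of_le zero_le_one] at ht
    exact (isStrictlyPositive_add_smul hQ (add_nonneg (smul_nonneg (sub_nonneg.2 ht.2) hC)
      (smul_nonneg ht.1 hD)) hl).isUnit
  have hM : ∀ t, HasDerivAt M (l • (D - C)) t := by
    intro t
    have h := ((((hasDerivAt_id t).const_sub 1).smul_const C).add
      ((hasDerivAt_id t).smul_const D)).const_smul l |>.const_add Q
    refine h.congr_deriv ?_
    simp [sub_eq_add_neg, add_comm]
  have hR : ContinuousOn (fun t => Ring.inverse (M t)) (Set.uIcc 0 1) := fun t ht =>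
    ((differentiableAt_inverse (𝕜 := ℝ) (hu t ht)).continuousAt.comp
      (hM t).continuousAt).continuousWithinAt
  have hd : ∀ t ∈ Set.uIcc (0 : ℝ) 1, HasDerivAt (fun s => -(Q * Ring.inverse (M s) * Q))
      (l • (Q * Ring.inverse (M t) * (D - C) * Ring.inverse (M t) * Q)) t := by
    intro t ht
    refine (hasDerivAt_mul_inverse_mul (hM t) (hu t ht) Q Q).neg.congr_deriv ?_
    simp only [mul_smul_comm, smul_mul_assoc, neg_neg]
  have hint : IntervalIntegrable
      (fun t => l • (Q * Ring.inverse (M t) * (D - C) * Ring.inverse (M t) * Q)) volume 0 1 :=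
    (ContinuousOn.const_smul ((((continuousOn_const.mul hR).mul continuousOn_const).mul hR).mul
      continuousOn_const) l).intervalIntegrable
  rw [← intervalIntegral.integral_smul, intervalIntegral.integral_eq_sub_of_hasDerivAt hd hint]
  simp [hMdef, sub_eq_add_neg, add_comm]

end Segment

/-- **Corollary 2.1.** If `f(t) = a + b t + ∫₀^∞ tλ/(t+λ) dw(λ)` on `(0,∞)`, then for all
strictly positive operators `C, D, Q`,
`𝒫_f(Q,D) - 𝒫_f(Q,C) = a(D - C) + ∫₀^∞ λ [∫₀¹ Q(Q + λ((1-t)C + tD))⁻¹ (D - C) (Q + λ((1-t)C + tD))⁻¹ Q dt] dw(λ)`. -/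
theorem stmt_4 (f : ℝ → ℝ) (a b : ℝ) (hb : 0 ≤ b) (w : Measure ℝ)
    (hf : ContinuousOn f (Set.Ioi 0))
    (hw : IntegrableOn (fun l => l / (1 + l)) (Set.Ioi 0) w)
    (hrep : ∀ t > (0:ℝ), f t = a + b * t + ∫ l in Set.Ioi 0, t * l / (t + l) ∂w)
    (C D Q : H →L[ℂ] H) (hC : StrictlyPos C) (hD : StrictlyPos D) (hQ : StrictlyPos Q) :
    persp f Q D - persp f Q C = a • (D - C) +
      ∫ l in Set.Ioi (0:ℝ), l •
        (∫ t in (0:ℝ)..1, Q * Ring.inverse (Q + l • ((1 - t) • C + t • D)) * (D - C) *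
          Ring.inverse (Q + l • ((1 - t) • C + t • D)) * Q) ∂w := by
  rw [strictlyPos_iff_isStrictlyPositive] at hC hD hQ
  rw [persp_eq_add_integral hD hQ hf hw hrep, persp_eq_add_integral hC hQ hf hw hrep,
    add_sub_add_comm, add_sub_add_right_eq_sub, ← smul_sub,
    ← integral_sub (integrableOn_smul_mul_inverse_mul hD hQ hw)
      (integrableOn_smul_mul_inverse_mul hC hQ hw)]
  congr 1
  refine setIntegral_congr_fun measurableSet_Ioi fun l hl => ?_
  have hl : 0 ≤ l := (Set.mem_Ioi.1 hl).le
  rw [smul_intervalIntegral_segment hC.nonneg hD.nonneg hQ hl,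
    smul_mul_inverse_mul_self hQ hD.nonneg hl, smul_mul_inverse_mul_self hQ hC.nonneg hl,
    sub_sub_sub_cancel_left]
end

section
/- Let f : (0,∞) → ℝ admit the representation f(t) = a + b·t + ∫₀^∞ (tλ)/(t+λ) dw(λ) for all t > 0, where a ∈ ℝ, b ≥ 0 and w is a positive measure on (0,∞) with ∫₀^∞ λ/(1+λ) dw(λ) < ∞. If A, B, C, D are strictly positive operators on a complex Hilbert space H with A ≥ C and B ≥ D, then 𝒫_f(A,B) − 𝒫_f(C,D) ≥ b(A − C) + a(B − D). -/
open MeasureTheory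

variable {H : Type*} [NormedAddCommGroup H] [InnerProductSpace ℂ H] [CompleteSpace H]

theorem StrictlyPos.isStrictlyPositive {K : Type*} [NormedAddCommGroup K]
    [InnerProductSpace ℂ K] {T : K →L[ℂ] K} (hT : StrictlyPos T) :
    IsStrictlyPositive T :=
  ⟨(ContinuousLinearMap.nonneg_iff_isPositive T).2 hT.1, hT.2⟩

theorem StrictlyPos.isSelfAdjoint {T : H →L[ℂ] H} (hT : StrictlyPos T) : IsSelfAdjoint T :=
  hT.1.isSelfAdjoint

theorem StrictlyPos.spectrum_pos {T : H →L[ℂ] H} (hT : StrictlyPos T) {x : ℝ}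
    (hx : x ∈ spectrum ℝ T) : 0 < x :=
  hT.isStrictlyPositive.spectrum_pos hx

theorem StrictlyPos.continuousOn_inv_sqrt {T : H →L[ℂ] H} (hT : StrictlyPos T) :
    ContinuousOn (fun x : ℝ => (Real.sqrt x)⁻¹) (spectrum ℝ T) :=
  Real.continuous_sqrt.continuousOn.inv₀ fun _ hx => (Real.sqrt_pos.2 (hT.spectrum_pos hx)).ne'

theorem opSqrt_isSelfAdjoint (T : H →L[ℂ] H) : IsSelfAdjoint (opSqrt T) :=
  cfc_predicate _ _

theorem opInvSqrt_isSelfAdjoint (T : H →L[ℂ] H) : IsSelfAdjoint (opInvSqrt T) :=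
  cfc_predicate _ _

theorem StrictlyPos.opSqrt_mul_self {T : H →L[ℂ] H} (hT : StrictlyPos T) :
    opSqrt T * opSqrt T = T := by
  have hs := hT.isSelfAdjoint
  rw [opSqrt, ← cfc_mul (fun x : ℝ => Real.sqrt x) (fun x : ℝ => Real.sqrt x) T]
  conv_rhs => rw [← cfc_id' ℝ T]
  exact cfc_congr fun x hx => Real.mul_self_sqrt (hT.spectrum_pos hx).le

theorem StrictlyPos.opSqrt_mul_opInvSqrt {T : H →L[ℂ] H} (hT : StrictlyPos T) :
    opSqrt T * opInvSqrt T = 1 := by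
  have hs := hT.isSelfAdjoint
  rw [opSqrt, opInvSqrt, ← cfc_mul (fun x : ℝ => Real.sqrt x) (fun x : ℝ => (Real.sqrt x)⁻¹) T
    Real.continuous_sqrt.continuousOn hT.continuousOn_inv_sqrt, ← cfc_const_one ℝ T]
  exact cfc_congr fun x hx => mul_inv_cancel₀ (Real.sqrt_pos.2 (hT.spectrum_pos hx)).ne'

theorem StrictlyPos.opInvSqrt_mul_opSqrt {T : H →L[ℂ] H} (hT : StrictlyPos T) :
    opInvSqrt T * opSqrt T = 1 := by
  have := congrArg star hT.opSqrt_mul_opInvSqrt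
  rwa [star_mul, (opSqrt_isSelfAdjoint T).star_eq, (opInvSqrt_isSelfAdjoint T).star_eq,
    star_one] at this

theorem StrictlyPos.conj_opInvSqrt {A B : H →L[ℂ] H} (hA : StrictlyPos A) (hB : StrictlyPos B) :
    StrictlyPos (opInvSqrt B * A * opInvSqrt B) := by
  have hR : IsUnit (opInvSqrt B) :=
    ⟨⟨_, _, hB.opInvSqrt_mul_opSqrt, hB.opSqrt_mul_opInvSqrt⟩, rfl⟩
  refine ⟨?_, (hR.mul hA.2).mul hR⟩
  rw [← ContinuousLinearMap.nonneg_iff_isPositive]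
  exact (opInvSqrt_isSelfAdjoint B).conjugate_nonneg hA.isStrictlyPositive.nonneg

/-- The perspective of `t ↦ t l / (t + l)` is the inverse of `A⁻¹ + l⁻¹ B⁻¹`. -/
theorem persp_parallel_mul {A B : (H →L[ℂ] H)ˣ} (hA : StrictlyPos (A : H →L[ℂ] H))
    (hB : StrictlyPos (B : H →L[ℂ] H)) {l : ℝ} (hl : 0 < l) :
    persp (fun t => t * l / (t + l)) (A : H →L[ℂ] H) B *
        (↑A⁻¹ + l⁻¹ • (↑B⁻¹ : H →L[ℂ] H)) = 1 ∧
      (↑A⁻¹ + l⁻¹ • (↑B⁻¹ : H →L[ℂ] H)) *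
        persp (fun t => t * l / (t + l)) (A : H →L[ℂ] H) B = 1 := by
  set S := opSqrt (B : H →L[ℂ] H) with hS
  set R := opInvSqrt (B : H →L[ℂ] H) with hR
  have hSR : S * R = 1 := hB.opSqrt_mul_opInvSqrt
  have hRS : R * S = 1 := hB.opInvSqrt_mul_opSqrt
  have hSS : S * S = B := hB.opSqrt_mul_self
  have hT := hA.conj_opInvSqrt hB
  have hBinv : (↑B⁻¹ : H →L[ℂ] H) = R * R := by
    refine Units.inv_eq_of_mul_eq_one_right ?_
    rw [← hSS, mul_assoc, ← mul_assoc S R R, hSR, one_mul, hSR]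
  let T : (H →L[ℂ] H)ˣ := ⟨R * A * R, S * ↑A⁻¹ * S, by
    calc _ = R * (A * (R * S) * ↑A⁻¹) * S := by noncomm_ring
      _ = 1 := by simp [hRS], by
    calc _ = S * (↑A⁻¹ * (S * R) * ↑A) * R := by noncomm_ring
      _ = 1 := by simp [hSR]⟩
  have hTpos : StrictlyPos (T : H →L[ℂ] H) := hT
  have hTs : IsSelfAdjoint (T : H →L[ℂ] H) := hTpos.isSelfAdjoint
  have hTinv : (↑T⁻¹ : H →L[ℂ] H) = S * ↑A⁻¹ * S := rfl
  have hinv : ContinuousOn (fun t : ℝ => t⁻¹) (spectrum ℝ (T : H →L[ℂ] H)) :=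
    continuousOn_id.inv₀ fun x hx => (hTpos.spectrum_pos hx).ne'
  have hcont : ContinuousOn (fun t : ℝ => t * l / (t + l)) (spectrum ℝ (T : H →L[ℂ] H)) := by
    refine ContinuousOn.div (by fun_prop) (by fun_prop) fun x hx => ?_
    have := hTpos.spectrum_pos hx
    positivity
  have hK : cfc (fun t : ℝ => t⁻¹ + l⁻¹) (T : H →L[ℂ] H) = ↑T⁻¹ + l⁻¹ • 1 := by
    rw [cfc_add_const l⁻¹ (fun t : ℝ => t⁻¹) (T : H →L[ℂ] H), cfc_inv_id T,
      Algebra.algebraMap_eq_smul_one]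
  have hsum : ↑A⁻¹ + l⁻¹ • (↑B⁻¹ : H →L[ℂ] H)
      = R * cfc (fun t : ℝ => t⁻¹ + l⁻¹) (T : H →L[ℂ] H) * R := by
    rw [hK, hTinv, hBinv, mul_add, add_mul, mul_smul_comm, mul_one, smul_mul_assoc]
    congr 1
    calc _ = (R * S) * ↑A⁻¹ * (S * R) := by simp [hRS, hSR]
      _ = _ := by noncomm_ring
  have h1 : cfc (fun t : ℝ => t * l / (t + l)) (T : H →L[ℂ] H) *
      cfc (fun t : ℝ => t⁻¹ + l⁻¹) (T : H →L[ℂ] H) = 1 := by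
    rw [← cfc_mul _ (fun t : ℝ => t⁻¹ + l⁻¹) _ hcont (hinv.add continuousOn_const),
      ← cfc_const_one ℝ (T : H →L[ℂ] H)]
    refine cfc_congr fun x hx => ?_
    have := hTpos.spectrum_pos hx
    field_simp
    ring
  have h2 : cfc (fun t : ℝ => t⁻¹ + l⁻¹) (T : H →L[ℂ] H) *
      cfc (fun t : ℝ => t * l / (t + l)) (T : H →L[ℂ] H) = 1 := by
    rw [cfc_commute_cfc _ _ _ |>.eq, h1]
  have hp : persp (fun t => t * l / (t + l)) (A : H →L[ℂ] H) B
      = S * cfc (fun t : ℝ => t * l / (t + l)) (T : H →L[ℂ] H) * S := rfl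
  rw [hsum, hp]
  generalize cfc (fun t : ℝ => t * l / (t + l)) (T : H →L[ℂ] H) = P at h1 h2 ⊢
  generalize cfc (fun t : ℝ => t⁻¹ + l⁻¹) (T : H →L[ℂ] H) = K at h1 h2 ⊢
  constructor
  · calc _ = S * (P * (S * R) * K) * R := by noncomm_ring
      _ = 1 := by rw [hSR, mul_one, h1, mul_one, hSR]
  · calc _ = R * (K * (R * S) * P) * S := by noncomm_ring
      _ = 1 := by rw [hRS, mul_one, h2, mul_one, hRS]

theorem persp_parallel_mono {A B C D : H →L[ℂ] H} (hA : StrictlyPos A) (hB : StrictlyPos B)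
    (hC : StrictlyPos C) (hD : StrictlyPos D) (hCA : C ≤ A) (hDB : D ≤ B) {l : ℝ} (hl : 0 < l) :
    persp (fun t => t * l / (t + l)) C D ≤ persp (fun t => t * l / (t + l)) A B := by
  lift A to (H →L[ℂ] H)ˣ using hA.2
  lift B to (H →L[ℂ] H)ˣ using hB.2
  lift C to (H →L[ℂ] H)ˣ using hC.2
  lift D to (H →L[ℂ] H)ˣ using hD.2
  obtain ⟨hAB₁, hAB₂⟩ := persp_parallel_mul hA hB hl
  obtain ⟨hCD₁, hCD₂⟩ := persp_parallel_mul hC hD hl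
  let X : (H →L[ℂ] H)ˣ := ⟨_, _, hAB₂, hAB₁⟩
  let Y : (H →L[ℂ] H)ˣ := ⟨_, _, hCD₂, hCD₁⟩
  have hle : (X : H →L[ℂ] H) ≤ Y :=
    add_le_add (CStarAlgebra.inv_le_inv hC.isStrictlyPositive.nonneg hCA)
      (smul_le_smul_of_nonneg_left
        (CStarAlgebra.inv_le_inv hD.isStrictlyPositive.nonneg hDB) (inv_nonneg.2 hl.le))
  have hX : 0 ≤ (X : H →L[ℂ] H) :=
    add_nonneg (CFC.inv_nonneg_of_nonneg A hA.isStrictlyPositive.nonneg)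
      (smul_nonneg (inv_nonneg.2 hl.le)
        (CFC.inv_nonneg_of_nonneg B hB.isStrictlyPositive.nonneg))
  exact CStarAlgebra.inv_le_inv hX hle

theorem mul_div_add_le {t l M : ℝ} (ht : 0 < t) (hl : 0 < l) (htM : t ≤ M) :
    t * l / (t + l) ≤ (M + 1) * (l / (1 + l)) := by
  rw [← mul_div_assoc, div_le_div_iff₀ (by positivity) (by positivity)]
  have h1 : t * (1 + l) ≤ (M + 1) * (t + l) := by nlinarith [mul_pos ht ht]
  nlinarith

/-- The integral representation of `f` passes to the functional calculus. -/
theorem StrictlyPos.cfc_eq_integral {f : ℝ → ℝ} {a b : ℝ} {w : Measure ℝ}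
    (hw : IntegrableOn (fun l => l / (1 + l)) (Set.Ioi 0) w)
    (hf : ContinuousOn f (Set.Ioi 0))
    (hrep : ∀ t > (0 : ℝ), f t = a + b * t + ∫ l in Set.Ioi 0, t * l / (t + l) ∂w)
    {T : H →L[ℂ] H} (hT : StrictlyPos T) :
    IntegrableOn (fun l => cfc (fun t : ℝ => t * l / (t + l)) T) (Set.Ioi 0) w ∧
      cfc f T = a • 1 + b • T + ∫ l in Set.Ioi 0, cfc (fun t : ℝ => t * l / (t + l)) T ∂w := by
  have hs := hT.isSelfAdjoint
  obtain ⟨M, hM⟩ := (spectrum.isCompact (𝕜 := ℝ) T).bddAbove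
  have hcont : ContinuousOn (Function.uncurry fun l t : ℝ => t * l / (t + l))
      (Set.Ioi 0 ×ˢ spectrum ℝ T) := by
    refine ContinuousOn.div (by fun_prop) (by fun_prop) ?_
    rintro ⟨l, t⟩ ⟨hl, ht⟩
    have hl : 0 < l := hl
    have := hT.spectrum_pos ht
    positivity
  have hbound : ∀ᵐ l ∂(w.restrict (Set.Ioi 0)), ∀ t ∈ spectrum ℝ T,
      ‖t * l / (t + l)‖ ≤ (M + 1) * (l / (1 + l)) := by
    refine ae_restrict_of_forall_mem measurableSet_Ioi fun l hl t ht => ?_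
    have hl : 0 < l := hl
    have htp := hT.spectrum_pos ht
    rw [Real.norm_of_nonneg (by positivity)]
    exact mul_div_add_le htp hl (hM ht)
  have hfin := (hw.const_mul (M + 1)).hasFiniteIntegral
  refine ⟨integrableOn_cfc measurableSet_Ioi _ _ T hcont hbound hfin, ?_⟩
  rw [← cfc_setIntegral measurableSet_Ioi _ _ T hcont hbound hfin]
  have hfT : ContinuousOn f (spectrum ℝ T) := hf.mono fun x hx => hT.spectrum_pos hx
  have hint : ContinuousOn (fun t => ∫ l in Set.Ioi 0, t * l / (t + l) ∂w) (spectrum ℝ T) := by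
    refine (hfT.sub (by fun_prop : ContinuousOn (fun t => a + b * t) _)).congr fun t ht => ?_
    simp [hrep t (hT.spectrum_pos ht)]
  have hlin : cfc (fun t : ℝ => a + b * t) T = a • 1 + b • T := by
    rw [cfc_const_add a (fun t : ℝ => b * t) T, cfc_const_mul b (fun t : ℝ => t) T, cfc_id' ℝ T,
      Algebra.algebraMap_eq_smul_one]
  rw [← hlin, ← cfc_add T (fun t : ℝ => a + b * t) _ (by fun_prop) hint]
  exact cfc_congr fun t ht => hrep t (hT.spectrum_pos ht)

theorem persp_eq_integral {f : ℝ → ℝ} {a b : ℝ} {w : Measure ℝ}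
    (hw : IntegrableOn (fun l => l / (1 + l)) (Set.Ioi 0) w)
    (hf : ContinuousOn f (Set.Ioi 0))
    (hrep : ∀ t > (0 : ℝ), f t = a + b * t + ∫ l in Set.Ioi 0, t * l / (t + l) ∂w)
    {A B : H →L[ℂ] H} (hA : StrictlyPos A) (hB : StrictlyPos B) :
    IntegrableOn (fun l => persp (fun t : ℝ => t * l / (t + l)) A B) (Set.Ioi 0) w ∧
      persp f A B = b • A + a • B +
        ∫ l in Set.Ioi 0, persp (fun t : ℝ => t * l / (t + l)) A B ∂w := by
  obtain ⟨hi, he⟩ := (hA.conj_opInvSqrt hB).cfc_eq_integral hw hf hrep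
  refine ⟨(hi.const_mul (opSqrt B)).mul_const (opSqrt B), ?_⟩
  simp only [persp]
  rw [integral_mul_const_of_integrable (hi.const_mul (opSqrt B)),
    integral_const_mul_of_integrable hi, he, mul_add, add_mul, mul_add, add_mul,
    mul_smul_comm, smul_mul_assoc, mul_one, hB.opSqrt_mul_self, mul_smul_comm, smul_mul_assoc,
    add_comm (b • A)]
  congr 3
  calc _ = (opSqrt B * opInvSqrt B) * A * (opInvSqrt B * opSqrt B) := by noncomm_ring
    _ = A := by rw [hB.opSqrt_mul_opInvSqrt, hB.opInvSqrt_mul_opSqrt, one_mul, mul_one]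

/-- **Theorem 2.3, (2.17a).** If `f(t) = a + b t + ∫₀^∞ tλ/(t+λ) dw(λ)` on `(0,∞)` and
`A ≥ C > 0`, `B ≥ D > 0`, then `𝒫_f(A,B) - 𝒫_f(C,D) ≥ b(A - C) + a(B - D)`. -/
theorem stmt_8 (f : ℝ → ℝ) (a b : ℝ) (hb : 0 ≤ b) (w : Measure ℝ)
    (hf : ContinuousOn f (Set.Ioi 0))
    (hw : IntegrableOn (fun l => l / (1 + l)) (Set.Ioi 0) w)
    (hrep : ∀ t > (0:ℝ), f t = a + b * t + ∫ l in Set.Ioi 0, t * l / (t + l) ∂w)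
    (A B C D : H →L[ℂ] H) (hA : StrictlyPos A) (hB : StrictlyPos B)
    (hC : StrictlyPos C) (hD : StrictlyPos D)
    (hAC : (A - C).IsPositive) (hBD : (B - D).IsPositive) :
    (persp f A B - persp f C D - (b • (A - C) + a • (B - D))).IsPositive := by
  obtain ⟨hiAB, heAB⟩ := persp_eq_integral hw hf hrep hA hB
  obtain ⟨hiCD, heCD⟩ := persp_eq_integral hw hf hrep hC hD
  have hmono := setIntegral_mono_on hiCD hiAB measurableSet_Ioi fun l hl =>
    persp_parallel_mono hA hB hC hD hAC hBD hl
  have h := (ContinuousLinearMap.le_def _ _).1 hmono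
  rw [heAB, heCD]
  convert h using 1
  simp only [smul_sub]
  abel
end
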